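/- Let κ₁ > 1 > κ₂ > 0 be real numbers and let a₁ > 0, a₂ > 0, a₃ ∈ ℝ. Suppose g has exactly one zero s in the interval (0, ∞). Then s ≥ t*, where t* = ln(−a₂·ln(κ₂)/(a₁·ln(κ₁)))/ln(κ₁/κ₂) is the unique extremum point of g; i.e., the least positive solution of g(t) = 0 is bounded below by t*. -/

import Mathlib

/-- The derivative of `a₁ * κ₁ ^ t + a₂ * κ₂ ^ t + a₃` with respect to `t`. -/
theorem hasDerivAt_dirichlet {κ₁ κ₂ : ℝ} (hκ₁ : 0 < κ₁) (hκ₂ : 0 < κ₂) (a₁ a₂ a₃ t : ℝ) :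
    HasDerivAt (fun t : ℝ => a₁ * κ₁ ^ t + a₂ * κ₂ ^ t + a₃)
      (a₁ * (κ₁ ^ t * Real.log κ₁) + a₂ * (κ₂ ^ t * Real.log κ₂)) t := by
  have h₁ := (Real.hasStrictDerivAt_const_rpow hκ₁ t).hasDerivAt
  have h₂ := (Real.hasStrictDerivAt_const_rpow hκ₂ t).hasDerivAt
  exact ((h₁.const_mul a₁).add (h₂.const_mul a₂)).add_const a₃

/-- The derivative of `a₁ * κ₁ ^ t + a₂ * κ₂ ^ t + a₃` is negative to the left of its zero. -/
theorem dirichlet_deriv_neg {κ₁ κ₂ a₁ a₂ t : ℝ} (hκ₁ : 1 < κ₁) (hκ₂1 : κ₂ < 1) (hκ₂0 : 0 < κ₂)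
    (ha₁ : 0 < a₁) (ha₂ : 0 < a₂)
    (ht : t < Real.log (-a₂ * Real.log κ₂ / (a₁ * Real.log κ₁)) / Real.log (κ₁ / κ₂)) :
    a₁ * (κ₁ ^ t * Real.log κ₁) + a₂ * (κ₂ ^ t * Real.log κ₂) < 0 := by
  have hκ₁0 : 0 < κ₁ := one_pos.trans hκ₁
  have hlog₁ : 0 < Real.log κ₁ := Real.log_pos hκ₁
  have hlog₂ : Real.log κ₂ < 0 := Real.log_neg hκ₂0 hκ₂1
  have hlog : 0 < Real.log (κ₁ / κ₂) :=
    Real.log_pos ((one_lt_div hκ₂0).2 (hκ₂1.trans hκ₁))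
  have hden : 0 < a₁ * Real.log κ₁ := mul_pos ha₁ hlog₁
  have hratio : 0 < -a₂ * Real.log κ₂ / (a₁ * Real.log κ₁) :=
    div_pos (mul_pos_of_neg_of_neg (neg_neg_of_pos ha₂) hlog₂) hden
  have hpow : κ₁ ^ t / κ₂ ^ t < -a₂ * Real.log κ₂ / (a₁ * Real.log κ₁) := by
    rw [← Real.div_rpow hκ₁0.le hκ₂0.le,
      ← Real.log_lt_log_iff (Real.rpow_pos_of_pos (div_pos hκ₁0 hκ₂0) t) hratio,
      Real.log_rpow (div_pos hκ₁0 hκ₂0)]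
    exact (lt_div_iff₀ hlog).1 ht
  rw [div_lt_div_iff₀ (Real.rpow_pos_of_pos hκ₂0 t) hden] at hpow
  linarith

/-- The function `a₁ * κ₁ ^ t + a₂ * κ₂ ^ t + a₃` tends to infinity at infinity. -/
theorem tendsto_dirichlet_atTop {κ₁ κ₂ a₁ a₂ : ℝ} (hκ₁ : 1 < κ₁) (hκ₂ : 0 < κ₂)
    (ha₁ : 0 < a₁) (ha₂ : 0 < a₂) (a₃ : ℝ) :
    Filter.Tendsto (fun t : ℝ => a₁ * κ₁ ^ t + a₂ * κ₂ ^ t + a₃) Filter.atTop Filter.atTop := by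
  refine Filter.tendsto_atTop_add_const_right _ _ ?_
  exact Filter.tendsto_atTop_mono
    (fun t => le_add_of_nonneg_right (mul_pos ha₂ (Real.rpow_pos_of_pos hκ₂ t)).le)
    ((tendsto_rpow_atTop_of_base_gt_one κ₁ hκ₁).const_mul_atTop ha₁)

/-- If `κ₁ > 1 > κ₂ > 0`, `a₁ > 0`, `a₂ > 0`, and
`g t = a₁ * κ₁ ^ t + a₂ * κ₂ ^ t + a₃` has exactly one zero `s` in `(0, ∞)`, then
`s ≥ t*`, where `t* = log (-a₂ * log κ₂ / (a₁ * log κ₁)) / log (κ₁ / κ₂)` is the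
unique extremum point of `g`. -/
theorem stmt_9 (κ₁ κ₂ a₁ a₂ a₃ : ℝ)
    (hκ₁ : 1 < κ₁) (hκ₂1 : κ₂ < 1) (hκ₂0 : 0 < κ₂)
    (ha₁ : 0 < a₁) (ha₂ : 0 < a₂)
    (g : ℝ → ℝ) (hg : ∀ t : ℝ, g t = a₁ * κ₁ ^ t + a₂ * κ₂ ^ t + a₃)
    (s : ℝ) (hs : 0 < s) (hzero : g s = 0)
    (huniq : ∀ t : ℝ, 0 < t → g t = 0 → t = s)
    (tstar : ℝ)
    (htstar : tstar = Real.log (-a₂ * Real.log κ₂ / (a₁ * Real.log κ₁))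
      / Real.log (κ₁ / κ₂)) :
    tstar ≤ s := by
  obtain rfl : g = fun t : ℝ => a₁ * κ₁ ^ t + a₂ * κ₂ ^ t + a₃ := funext hg
  have hderiv := hasDerivAt_dirichlet (one_pos.trans hκ₁) hκ₂0 a₁ a₂ a₃
  have hcont := continuous_iff_continuousAt.2 fun t => (hderiv t).continuousAt
  by_contra! hlt
  have hanti := strictAntiOn_of_deriv_neg (convex_Iic tstar) hcont.continuousOn fun t ht => by
    rw [interior_Iic, Set.mem_Iio, htstar] at ht
    rw [(hderiv t).deriv]
    exact dirichlet_deriv_neg hκ₁ hκ₂1 hκ₂0 ha₁ ha₂ ht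
  have hneg := hanti hlt.le (Set.mem_Iic.2 le_rfl) hlt
  rw [hzero] at hneg
  obtain ⟨T, hT, hle⟩ := (((tendsto_dirichlet_atTop hκ₁ hκ₂0 ha₁ ha₂ a₃).eventually_ge_atTop
    0).and (Filter.eventually_ge_atTop tstar)).exists
  obtain ⟨u, hu, hu0⟩ := intermediate_value_Icc hle hcont.continuousOn ⟨hneg.le, hT⟩
  have hsu : s < u := hlt.trans_le hu.1
  exact hsu.ne' (huniq u (hs.trans hsu) hu0)
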